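/- arXiv:2502.07100 — 2 statements merged into one kernel-verified Lean document; each statement's English description precedes it below -/
import Mathlib

section
/- Let K be a field of characteristic zero and n ≥ 2 an integer. Then there exists a constant C > 0, depending only on n, such that for every monic polynomial f ∈ K[T] of degree n and every finite subset A of K of cardinality A = #A, the number of n×n matrices over A with characteristic polynomial f satisfies #P_n(A; f) ≤ C·A^{n² − 2}. -/
namespace Matrix

variable {n K : Type*} [Fintype n] [DecidableEq n] [Field K]

/-- Over an infinite field, the characteristic polynomial of a matrix determines the one of its
square. -/
theorem charpoly_sq_eq_of_charpoly_eq [Infinite K] {X Y : Matrix n n K}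
    (h : X.charpoly = Y.charpoly) : (X ^ 2).charpoly = (Y ^ 2).charpoly := by
  have key (Z : Matrix n n K) (t : K) : (Z ^ 2).charpoly.eval (t ^ 2) =
      Z.charpoly.eval t * ((-1) ^ Fintype.card n * Z.charpoly.eval (-t)) := by
    rw [eval_charpoly, eval_charpoly, eval_charpoly, ← det_neg, ← det_mul]
    congr 1
    rw [map_pow, map_neg, neg_sub, sub_neg_eq_add, add_comm Z]
    have hc := scalar_commute t (fun _ => mul_comm _ _) Z
    exact hc.sq_sub_sq.trans
      ((Commute.refl _).sub_right hc |>.add_left (hc.symm.sub_right (Commute.refl _))).eq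
  apply Polynomial.expand_injective (n := 2) (by norm_num)
  refine Polynomial.funext fun t => ?_
  rw [Polynomial.expand_eval, Polynomial.expand_eval, key, key, h]

theorem trace_eq_of_charpoly_eq {X Y : Matrix n n K} (h : X.charpoly = Y.charpoly) :
    X.trace = Y.trace := by
  cases isEmpty_or_nonempty n
  · rw [Subsingleton.elim X Y]
  · rw [trace_eq_neg_charpoly_coeff, trace_eq_neg_charpoly_coeff, h]

theorem eq_of_charpoly_eq_of_eq_off_pair [CharZero K] {X Y : Matrix n n K}
    (h : X.charpoly = Y.charpoly) {i j k : n} (hij : i ≠ j) (hX : X i j ≠ 0)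
    (hXY : ∀ a b, (a, b) ≠ (k, k) → (a, b) ≠ (j, i) → X a b = Y a b) : X = Y := by
  have hkk : X k k = Y k k := by
    have ht := trace_eq_of_charpoly_eq h
    simp only [trace, diag_apply] at ht
    rw [← Finset.add_sum_erase _ _ (Finset.mem_univ k),
      ← Finset.add_sum_erase _ (fun a => Y a a) (Finset.mem_univ k),
      Finset.sum_congr rfl fun a ha => hXY a a (by simpa using Finset.ne_of_mem_erase ha)
        (by simp only [ne_eq, Prod.mk.injEq, not_and]; rintro rfl; exact hij.symm)] at ht
    exact add_right_cancel ht
  have hY : Y = X + single j i (Y j i - X j i) := by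
    ext a b
    by_cases hab : j = a ∧ i = b
    · obtain ⟨rfl, rfl⟩ := hab
      simp
    · rw [add_apply, single_apply, if_neg hab, add_zero]
      by_cases hk : (a, b) = (k, k)
      · simp only [Prod.mk.injEq] at hk
        rw [hk.1, hk.2, hkk]
      · exact (hXY a b hk (by simp only [ne_eq, Prod.mk.injEq]; tauto)).symm
  have ht := trace_eq_of_charpoly_eq (charpoly_sq_eq_of_charpoly_eq h)
  rw [hY, sq, sq, mul_add, add_mul, add_mul, trace_add, trace_add, trace_add,
    trace_mul_comm X (single _ _ _), single_mul_single_of_ne _ _ _ _ hij, trace_zero,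
    trace_single_mul] at ht
  have hc : Y j i - X j i = 0 := by
    have : (2 : K) * (X i j * (Y j i - X j i)) = 0 := by
      simp only [smul_eq_mul] at ht
      linear_combination -ht
    simpa [hX] using this
  rw [hY, hc, single_zero, add_zero]

theorem ncard_charpoly_eq_of_apply_ne_zero_le [CharZero K] (f : Polynomial K) (A : Finset K)
    {i j : n} (hij : i ≠ j) :
    {X : Matrix n n K | ((∀ a b, X a b ∈ A) ∧ X.charpoly = f) ∧ X i j ≠ 0}.ncard ≤
      A.card ^ (Fintype.card n ^ 2 - 2) := by
  classical
  let s : Finset (n × n) := Finset.univ \ {(i, i), (j, i)}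
  have hs : s.card = Fintype.card n ^ 2 - 2 := by
    rw [Finset.card_sdiff_of_subset (Finset.subset_univ _),
      Finset.card_pair (by simpa using hij), Finset.card_univ, Fintype.card_prod, sq]
  let F (X : Matrix n n K) : s → K := fun p => X p.1.1 p.1.2
  calc
    _ ≤ ((Fintype.piFinset fun _ : s => A : Finset (s → K)) : Set (s → K)).ncard := by
      refine Set.ncard_le_ncard_of_injOn F (fun X hX => ?_) (fun X hX Y hY hXY => ?_)
        (Finset.finite_toSet _)
      · simp only [Finset.mem_coe, Fintype.mem_piFinset]
        exact fun p => hX.1.1 _ _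
      · refine eq_of_charpoly_eq_of_eq_off_pair (hX.1.2.trans hY.1.2.symm) hij hX.2 (k := i)
          fun a b h₁ h₂ => congrFun hXY ⟨(a, b), ?_⟩
        simp only [s, Finset.mem_sdiff, Finset.mem_univ, Finset.mem_insert, Finset.mem_singleton,
          true_and]
        tauto
    _ = _ := by
      rw [Set.ncard_coe_finset, Fintype.card_piFinset, Finset.prod_const, Finset.card_univ,
        Fintype.card_coe, hs]

theorem ncard_isDiag_charpoly_eq_le (f : Polynomial K) (S : Set (Matrix n n K))
    (hS : ∀ X ∈ S, X.charpoly = f ∧ X.IsDiag) : S.ncard ≤ f.natDegree ^ Fintype.card n := by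
  classical
  calc
    _ ≤ ((Fintype.piFinset fun _ : n => f.roots.toFinset : Finset (n → K)) :
        Set (n → K)).ncard := by
      refine Set.ncard_le_ncard_of_injOn diag (fun X hX => ?_) (fun X hX Y hY hXY => ?_)
        (Finset.finite_toSet _)
      · obtain ⟨rfl, hX⟩ := hS X hX
        simp only [Finset.mem_coe, Fintype.mem_piFinset, Multiset.mem_toFinset]
        intro i
        rw [Polynomial.mem_roots (charpoly_monic X).ne_zero, Polynomial.IsRoot.def, ← hX.diagonal_diag,
          charpoly_diagonal, Polynomial.eval_prod]
        exact Finset.prod_eq_zero (Finset.mem_univ i) (by simp)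
      · rw [← (hS X hX).2.diagonal_diag, hXY, (hS Y hY).2.diagonal_diag]
    _ ≤ _ := by
      rw [Set.ncard_coe_finset, Fintype.card_piFinset, Finset.prod_const, Finset.card_univ]
      exact Nat.pow_le_pow_left ((Multiset.toFinset_card_le _).trans f.card_roots') _

end Matrix

theorem count_matrices_charpoly_trivial (n : ℕ) (hn : 2 ≤ n) :
    ∃ C : ℝ, 0 < C ∧ ∀ (K : Type*) [Field K] [CharZero K],
      ∀ f : Polynomial K, f.Monic → f.natDegree = n →
      ∀ A : Finset K,
      ({X : Matrix (Fin n) (Fin n) K | (∀ i j, X i j ∈ A) ∧ X.charpoly = f}.ncard : ℝ) ≤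
        C * (A.card : ℝ) ^ (n ^ 2 - 2) := by
  refine ⟨n * n + n ^ n, by positivity, fun K _ _ f _ hf A => ?_⟩
  set S := {X : Matrix (Fin n) (Fin n) K | (∀ i j, X i j ∈ A) ∧ X.charpoly = f}
  obtain rfl | hA := A.eq_empty_or_nonempty
  · have : S = ∅ := Set.eq_empty_of_forall_notMem fun X hX =>
      Finset.notMem_empty _ (hX.1 ⟨0, by omega⟩ ⟨0, by omega⟩)
    rw [this, Set.ncard_empty, Nat.cast_zero]
    positivity
  have hfin : S.Finite := (Set.Finite.pi' fun _ : Fin n =>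
    Set.Finite.pi' fun _ : Fin n => A.finite_toSet).subset fun X hX => hX.1
  let P : Finset (Fin n × Fin n) := Finset.univ.offDiag
  let U : Set (Matrix (Fin n) (Fin n) K) := ⋃ p ∈ P, {X | X ∈ S ∧ X p.1 p.2 ≠ 0}
  have hU : U.ncard ≤ n * n * A.card ^ (n ^ 2 - 2) :=
    calc
      U.ncard ≤ ∑ p ∈ P, {X | X ∈ S ∧ X p.1 p.2 ≠ 0}.ncard := Finset.set_ncard_biUnion_le _ _
      _ ≤ P.card • A.card ^ (n ^ 2 - 2) := by
        refine Finset.sum_le_card_nsmul _ _ _ fun p hp => ?_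
        simpa only [Fintype.card_fin] using! Matrix.ncard_charpoly_eq_of_apply_ne_zero_le f A (Finset.mem_offDiag.1 hp).2.2
      _ ≤ n * n * A.card ^ (n ^ 2 - 2) := by
        refine Nat.mul_le_mul_right _ ((Finset.card_le_univ P).trans_eq ?_)
        simp
  have hD : {X | X ∈ S ∧ X.IsDiag}.ncard ≤ n ^ n * A.card ^ (n ^ 2 - 2) := by
    have h := Matrix.ncard_isDiag_charpoly_eq_le f {X | X ∈ S ∧ X.IsDiag}
      fun X hX => ⟨hX.1.2, hX.2⟩
    rw [Fintype.card_fin, hf] at h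
    exact h.trans (Nat.le_mul_of_pos_right _ (pow_pos hA.card_pos _))
  have hsub : S ⊆ U ∪ {X | X ∈ S ∧ X.IsDiag} := fun X hX => by
    by_cases h : X.IsDiag
    · exact Or.inr ⟨hX, h⟩
    · simp only [Matrix.IsDiag, Pairwise, not_forall] at h
      obtain ⟨i, j, hij, h⟩ := h
      exact Or.inl (Set.mem_biUnion (x := (i, j)) (by simpa [P] using hij) ⟨hX, h⟩)
  have hUS : U ⊆ S := Set.iUnion₂_subset fun p _ X hX => hX.1
  have := (Set.ncard_le_ncard hsub ((hfin.subset hUS).union (hfin.subset fun X hX => hX.1))).trans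
    ((Set.ncard_union_le _ _).trans (add_le_add hU hD))
  rw [← add_mul] at this
  exact_mod_cast this
end

section
/- For every positive integer n, one has max over k ∈ {0, 1, …, ⌊n/2⌋} of min{⌊(n+k)/3⌋, ⌊(n−k)/2⌋} = ⌊2n/5⌋, and this maximum is attained at k = ⌊n/5⌋. -/
theorem maxmin_identity (n : ℕ) (hn : 0 < n) :
    (Finset.range (n / 2 + 1)).sup (fun k => min ((n + k) / 3) ((n - k) / 2)) = 2 * n / 5 ∧
    min ((n + n / 5) / 3) ((n - n / 5) / 2) = 2 * n / 5 := by
  have attained : min ((n + n / 5) / 3) ((n - n / 5) / 2) = 2 * n / 5 := by omega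
  refine ⟨le_antisymm (Finset.sup_le fun k hk => ?_) ?_, attained⟩
  · rw [Finset.mem_range] at hk
    omega
  · rw [← attained]
    exact Finset.le_sup (f := fun k => min ((n + k) / 3) ((n - k) / 2))
      (Finset.mem_range.mpr (by omega))
end
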